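/- Under the hypotheses of Theorem 3.2, for n large enough, P(D_{n,ε}) ≥ 1 − 2(m−1)·exp(−n(−((1+ln(1+v))/v)(m−1) + η²ε²/(2m³D²))), where D_{n,ε} is the event that every pair (x_1, x_j) of aligned indices in any optimal alignment satisfies p_j^(1)x_1 − p_j^(1)nε − p_j^(1)v ≤ x_j ≤ p_j^(2)x_1 + p_j^(2)nε + p_j^(2)v for all j = 2,...,m. -/

import Mathlib

open MeasureTheory Filter

noncomputable def alignScore {A : Type*} {m n k : ℕ} (S : (Fin m → A) → ℝ)
    (w : Fin m → Fin n → A) (π : Fin m → Fin k → Fin n) : ℝ :=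
  ∑ i : Fin k, S (fun j => w j (π j i))

noncomputable def optScore {A : Type*} (m n : ℕ) (S : (Fin m → A) → ℝ)
    (w : Fin m → Fin n → A) : ℝ :=
  sSup {x : ℝ | ∃ (k : ℕ) (π : Fin m → Fin k → Fin n),
    (∀ j, StrictMono (π j)) ∧ x = alignScore S w π}

def PermInvariant {A : Type*} {m : ℕ} (S : (Fin m → A) → ℝ) : Prop :=
  ∀ (σ : Equiv.Perm (Fin m)) (x : Fin m → A), S (x ∘ σ) = S x

def BddDiffOne {A : Type*} {m : ℕ} (S : (Fin m → A) → ℝ) (D : ℝ) : Prop :=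
  ∀ x y : Fin m → A, (∃ j₀, ∀ j, j ≠ j₀ → x j = y j) → |S x - S y| ≤ D

noncomputable def wordMeasure {A : Type*} [MeasurableSpace A] (p : Measure A) (m n : ℕ) :
    Measure (Fin m → Fin n → A) :=
  Measure.pi fun _ => Measure.pi fun _ => p

noncomputable def expL {A : Type*} [MeasurableSpace A] (p : Measure A) (m n : ℕ)
    (S : (Fin m → A) → ℝ) : ℝ :=
  ∫ w, optScore m n S w ∂(wordMeasure p m n)

noncomputable def optScoreV {A : Type*} (m : ℕ) (ℓ : Fin m → ℕ) (S : (Fin m → A) → ℝ)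
    (w : ∀ j : Fin m, Fin (ℓ j) → A) : ℝ :=
  sSup {x : ℝ | ∃ (k : ℕ) (π : ∀ j : Fin m, Fin k → Fin (ℓ j)),
    (∀ j, StrictMono (π j)) ∧ x = ∑ i : Fin k, S (fun j => w j (π j i))}

noncomputable def wordMeasureV {A : Type*} [MeasurableSpace A] (p : Measure A) {m : ℕ}
    (ℓ : Fin m → ℕ) : Measure (∀ j : Fin m, Fin (ℓ j) → A) :=
  Measure.pi fun _ => Measure.pi fun _ => p

noncomputable def expLV {A : Type*} [MeasurableSpace A] (p : Measure A) {m : ℕ}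
    (ℓ : Fin m → ℕ) (S : (Fin m → A) → ℝ) : ℝ :=
  ∫ w, optScoreV m ℓ S w ∂(wordMeasureV p ℓ)

noncomputable def blockScore {A : Type*} {m n : ℕ} (S : (Fin m → A) → ℝ)
    (w : Fin m → Fin n → A) (lo hi : Fin m → ℕ) : ℝ :=
  sSup {x : ℝ | ∃ (k : ℕ) (π : Fin m → Fin k → Fin n),
    (∀ j, StrictMono (π j)) ∧ (∀ j i, lo j ≤ (π j i : ℕ) ∧ (π j i : ℕ) < hi j) ∧
    x = ∑ i : Fin k, S (fun j => w j (π j i))}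

open scoped Classical

def IsDecomp (m n d v : ℕ) (r : Fin m → ℕ → ℕ) : Prop :=
  (∀ j : Fin m, (j : ℕ) = 0 → ∀ k, r j k = v * k) ∧
  ∀ j : Fin m, Monotone (r j) ∧ r j 0 = 0 ∧ r j d = n

noncomputable def decompScore {A : Type*} {m n : ℕ} (S : (Fin m → A) → ℝ)
    (w : Fin m → Fin n → A) (d : ℕ) (r : Fin m → ℕ → ℕ) : ℝ :=
  ∑ k ∈ Finset.range d, blockScore S w (fun j => r j k) (fun j => r j (k + 1))

def GoodCell (m v : ℕ) (p1 p2 : Fin m → ℝ) (r : Fin m → ℕ → ℕ) (k : ℕ) : Prop :=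
  ∀ j : Fin m, (j : ℕ) ≠ 0 →
    (v : ℝ) * p1 j ≤ (r j (k + 1) : ℝ) - (r j k : ℝ) ∧
    (r j (k + 1) : ℝ) - (r j k : ℝ) ≤ (v : ℝ) * p2 j


section Helpers

open ProbabilityTheory

lemma integrable_fin {X : Type*} [Finite X] [MeasurableSpace X] (μ : Measure X)
    [IsFiniteMeasure μ] {f : X → ℝ} (hf : Measurable f) : Integrable f μ := by
  obtain ⟨C, hC⟩ := (Set.finite_range (fun x => ‖f x‖)).bddAbove
  exact Integrable.of_bound hf.aestronglyMeasurable C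
    (Filter.Eventually.of_forall fun x => hC ⟨x, rfl⟩)

lemma map_words {A : Type*} [MeasurableSpace A] (p : Measure A) [IsProbabilityMeasure p]
    {m : ℕ} {ι : Type*} [Fintype ι] (ℓ : Fin m → ℕ) (e : ∀ j, Fin (ℓ j) → ι)
    (he : Function.Injective (fun x : Σ j, Fin (ℓ j) => e x.1 x.2)) :
    MeasurePreserving (fun (W : ι → A) (j : Fin m) (i : Fin (ℓ j)) => W (e j i))
      (Measure.pi fun _ => p) (wordMeasureV p ℓ) := by
  refine ⟨by fun_prop, ?_⟩
  have h1 : iIndepFun (fun (i : ι) (ω : ι → A) => ω i) (Measure.pi fun _ : ι => p) :=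
    iIndepFun_pi (X := fun _ a => a) (fun i => aemeasurable_id)
  have h2 := h1.precomp he
  have h3 := (iIndepFun_iff_map_fun_eq_pi_map (fun i => (measurable_pi_apply _).aemeasurable)).1 h2
  have h4 : ∀ i : Σ j, Fin (ℓ j), (Measure.pi fun _ : ι => p).map (fun ω => ω (e i.1 i.2)) = p :=
    fun i => (measurePreserving_eval (fun _ : ι => p) _).map_eq
  simp only [h4] at h3
  have h5 := Measure.infinitePi_map_piCurry (X := fun (j : Fin m) (_ : Fin (ℓ j)) => A)
    (fun _ _ => p)
  simp only [Measure.infinitePi_eq_pi] at h5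
  rw [wordMeasureV, ← h5, ← h3, Measure.map_map (by fun_prop) (by fun_prop)]
  rfl

lemma mgf_pi {A : Type*} [Finite A] [MeasurableSpace A] (p : Measure A)
    [IsProbabilityMeasure p] (c s : ℝ) : ∀ (N : ℕ) (f : (Fin N → A) → ℝ), Measurable f →
    (∀ x i a, |f (Function.update x i a) - f x| ≤ c) →
    ∫ x, Real.exp (s * (f x - ∫ y, f y ∂(Measure.pi fun _ => p))) ∂(Measure.pi fun _ => p)
      ≤ Real.exp (N * (c ^ 2 * s ^ 2 / 8)) := by
  intro N
  induction N with
  | zero =>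
    intro f hf hc
    have : ∀ x, f x = f default := fun x => by rw [Subsingleton.elim x default]
    simp [this]
  | succ N ih =>
    intro f hf hc
    set P := (Measure.pi fun _ : Fin N => p) with hP
    set F : A × (Fin N → A) → ℝ := fun z => f (Fin.cons z.1 z.2) with hF
    have hcons : Measurable (fun z : A × (Fin N → A) => (Fin.cons z.1 z.2 : Fin (N+1) → A)) := by
      refine measurable_pi_iff.2 fun i => ?_
      refine Fin.cases ?_ (fun i => ?_) i
      · simpa using measurable_fst
      · simp only [Fin.cons_succ]; fun_prop
    have hFm : Measurable F := hf.comp hcons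
    have hmp := (measurePreserving_piFinSuccAbove (fun _ : Fin (N+1) => p) 0).symm
    have hint : ∀ h : (Fin (N+1) → A) → ℝ, ∫ x, h x ∂(Measure.pi fun _ : Fin (N+1) => p)
        = ∫ z, h (Fin.cons z.1 z.2) ∂(p.prod P) := by
      intro h
      rw [← hmp.integral_comp (MeasurableEquiv.measurableEmbedding _)]
      congr 1; ext z; congr 1
      simp [MeasurableEquiv.piFinSuccAbove, Fin.insertNthEquiv]
    have hgm : Measurable (fun x : Fin N → A => ∫ a, F (a, x) ∂p) := by
      have := (hFm.comp measurable_swap).stronglyMeasurable.integral_prod_right' (ν := p)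
      exact this.measurable
    set g : (Fin N → A) → ℝ := fun x => ∫ a, F (a, x) ∂p with hg
    have hFa : ∀ x, Measurable (fun a => F (a, x)) := fun x => by fun_prop
    have hgc : ∀ x i a, |g (Function.update x i a) - g x| ≤ c := by
      intro x i a
      rw [hg]
      simp only
      rw [← integral_sub (integrable_fin _ (hFa _)) (integrable_fin _ (hFa _))]
      have := norm_integral_le_of_norm_le_const (μ := p) (C := c)
        (f := fun b => F (b, Function.update x i a) - F (b, x))
        (Filter.Eventually.of_forall fun b => by
          simp only [hF, Real.norm_eq_abs]
          rw [Fin.cons_update]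
          exact hc _ _ _)
      simpa using this
    have hEf : ∫ y, f y ∂(Measure.pi fun _ : Fin (N+1) => p) = ∫ x, g x ∂P := by
      rw [hint, integral_prod_symm (fun z : A × (Fin N → A) => f (Fin.cons z.1 z.2)) (integrable_fin _ hFm)]
    rw [hEf, hint]
    set E := ∫ x, g x ∂P with hE
    have hexpm : Measurable (fun z : A × (Fin N → A) => Real.exp (s * (f (Fin.cons z.1 z.2) - E))) :=
      Real.measurable_exp.comp (measurable_const.mul (hFm.sub_const _))
    rw [integral_prod_symm _ (integrable_fin _ hexpm)]
    have hone : ∀ x, ∫ a, Real.exp (s * (f (Fin.cons a x) - E)) ∂p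
        ≤ Real.exp (s * (g x - E)) * Real.exp (c ^ 2 * s ^ 2 / 8) := by
      intro x
      have hosc : ∀ a b, |F (a, x) - F (b, x)| ≤ c := by
        intro a b
        have := hc (Fin.cons b x) 0 a
        rwa [Fin.update_cons_zero] at this
      obtain ⟨a0⟩ : Nonempty A := nonempty_of_isProbabilityMeasure p
      have : Nonempty A := ⟨a0⟩
      obtain ⟨lo, hlo⟩ := Finite.exists_min (fun a => F (a, x))
      have hsg := hasSubgaussianMGF_of_mem_Icc (μ := p) (X := fun a => F (a, x))
        (a := F (lo, x)) (b := F (lo, x) + c) (hFa x).aemeasurable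
        (Filter.Eventually.of_forall fun a => ⟨hlo a, by
          have := (abs_le.1 (hosc a lo)).2; linarith⟩)
      have h := hsg.mgf_le s
      have hpar : ((‖F (lo, x) + c - F (lo, x)‖₊ / 2) ^ 2 : NNReal) * s ^ 2 / 2
          = c ^ 2 * s ^ 2 / 8 := by
        push_cast
        have : ‖F (lo, x) + c - F (lo, x)‖ = |c| := by simp
        rw [this, div_pow, sq_abs]; ring
      rw [hpar, mgf] at h
      calc ∫ a, Real.exp (s * (f (Fin.cons a x) - E)) ∂p
          = ∫ a, Real.exp (s * (g x - E)) * Real.exp (s * (F (a, x) - g x)) ∂p := by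
            congr 1; ext a; rw [← Real.exp_add]; congr 1; simp only [hF]; ring
        _ = Real.exp (s * (g x - E)) * ∫ a, Real.exp (s * (F (a, x) - g x)) ∂p :=
            integral_const_mul _ _
        _ ≤ _ := by
            gcongr
    have hgE : Measurable fun x => Real.exp (s * (g x - E)) := by fun_prop
    calc ∫ x, ∫ a, Real.exp (s * (f (Fin.cons a x) - E)) ∂p ∂P
        ≤ ∫ x, Real.exp (s * (g x - E)) * Real.exp (c ^ 2 * s ^ 2 / 8) ∂P := by
          refine integral_mono ?_ ?_ hone
          · refine integrable_fin _ ?_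
            have := (hexpm.comp measurable_swap).stronglyMeasurable.integral_prod_right' (ν := p)
            exact this.measurable
          · exact integrable_fin _ (hgE.mul_const _)
      _ = (∫ x, Real.exp (s * (g x - E)) ∂P) * Real.exp (c ^ 2 * s ^ 2 / 8) :=
          integral_mul_const _ _
      _ ≤ Real.exp (N * (c ^ 2 * s ^ 2 / 8)) * Real.exp (c ^ 2 * s ^ 2 / 8) := by
          gcongr
          exact ih g hgm hgc
      _ = _ := by rw [← Real.exp_add]; congr 1; push_cast; ring

lemma mcdiarmid {A : Type*} [Finite A] [MeasurableSpace A] (p : Measure A)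
    [IsProbabilityMeasure p] (c t : ℝ) (hc0 : 0 < c) (ht : 0 < t) (N : ℕ) (hN : 0 < N)
    (f : (Fin N → A) → ℝ) (hf : Measurable f)
    (hc : ∀ x i a, |f (Function.update x i a) - f x| ≤ c)
    (hE : ∫ y, f y ∂(Measure.pi fun _ => p) ≤ -t) :
    (Measure.pi fun _ : Fin N => p).real {x | 0 ≤ f x} ≤ Real.exp (-2 * t ^ 2 / (N * c ^ 2)) := by
  set P := (Measure.pi fun _ : Fin N => p) with hP
  set E := ∫ y, f y ∂P with hEd
  have hN' : (0:ℝ) < N := by exact_mod_cast hN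
  set s : ℝ := 4 * t / (N * c ^ 2) with hs
  have hs0 : 0 < s := by positivity
  have h1 : P.real {x | 0 ≤ f x} ≤ P.real {x | t ≤ f x - E} := by
    apply measureReal_mono
    · intro x hx
      simp only [Set.mem_ofPred_eq] at *
      linarith
    · exact measure_ne_top _ _
  have hm : Measurable fun x => Real.exp (s * (f x - E)) := by fun_prop
  have h2 := measure_ge_le_exp_mul_mgf (μ := P) (X := fun x => f x - E) t hs0.le
    (integrable_fin _ hm)
  have h3 := mgf_pi p c s N f hf hc
  refine h1.trans (h2.trans ?_)
  rw [mgf]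
  calc Real.exp (-s * t) * ∫ x, Real.exp (s * (f x - E)) ∂P
      ≤ Real.exp (-s * t) * Real.exp (N * (c ^ 2 * s ^ 2 / 8)) := by gcongr
    _ = _ := by
      rw [← Real.exp_add]; congr 1
      rw [hs]; field_simp; ring

lemma bdd_optV {A : Type*} {m : ℕ} (hm : 0 < m) (ℓ : Fin m → ℕ) (S : (Fin m → A) → ℝ)
    (sStar : ℝ) (hSb : ∀ x, S x ≤ sStar) (w : ∀ j : Fin m, Fin (ℓ j) → A) :
    BddAbove {x : ℝ | ∃ (k : ℕ) (π : ∀ j : Fin m, Fin k → Fin (ℓ j)),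
      (∀ j, StrictMono (π j)) ∧ x = ∑ i : Fin k, S (fun j => w j (π j i))} := by
  refine ⟨ℓ ⟨0, hm⟩ * |sStar|, ?_⟩
  rintro x ⟨k, π, hπ, rfl⟩
  have hk : k ≤ ℓ ⟨0, hm⟩ := by
    simpa using Fintype.card_le_of_injective _ (hπ ⟨0, hm⟩).injective
  calc ∑ i : Fin k, S (fun j => w j (π j i)) ≤ ∑ _i : Fin k, |sStar| :=
        Finset.sum_le_sum fun i _ => (hSb _).trans (le_abs_self _)
    _ = k * |sStar| := by simp
    _ ≤ _ := by gcongr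

lemma le_optV {A : Type*} {m : ℕ} (hm : 0 < m) (ℓ : Fin m → ℕ) (S : (Fin m → A) → ℝ)
    (sStar : ℝ) (hSb : ∀ x, S x ≤ sStar) (w : ∀ j : Fin m, Fin (ℓ j) → A)
    (k : ℕ) (π : ∀ j : Fin m, Fin k → Fin (ℓ j)) (hπ : ∀ j, StrictMono (π j)) :
    ∑ i : Fin k, S (fun j => w j (π j i)) ≤ optScoreV m ℓ S w :=
  le_csSup (bdd_optV hm ℓ S sStar hSb w) ⟨k, π, hπ, rfl⟩

lemma optV_le {A : Type*} {m : ℕ} (ℓ : Fin m → ℕ) (S : (Fin m → A) → ℝ)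
    (w : ∀ j : Fin m, Fin (ℓ j) → A) (C : ℝ)
    (h : ∀ (k : ℕ) (π : ∀ j : Fin m, Fin k → Fin (ℓ j)), (∀ j, StrictMono (π j)) →
      ∑ i : Fin k, S (fun j => w j (π j i)) ≤ C) : optScoreV m ℓ S w ≤ C := by
  refine csSup_le ⟨_, 0, fun _ i => i.elim0, fun _ i => i.elim0, rfl⟩ ?_
  rintro x ⟨k, π, hπ, rfl⟩
  exact h k π hπ

lemma measurable_optV {A : Type*} [MeasurableSpace A] {m : ℕ} (ℓ : Fin m → ℕ)
    (S : (Fin m → A) → ℝ) (hS : Measurable S) : Measurable (optScoreV m ℓ S) := by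
  set I := Σ k : ℕ, {π : ∀ j : Fin m, Fin k → Fin (ℓ j) // ∀ j, StrictMono (π j)}
  have : optScoreV m ℓ S = fun w => ⨆ z : I, ∑ i : Fin z.1, S (fun j => w j (z.2.1 j i)) := by
    ext w
    rw [optScoreV, iSup]
    congr 1
    ext x
    constructor
    · rintro ⟨k, π, hπ, rfl⟩
      exact ⟨⟨k, π, hπ⟩, rfl⟩
    · rintro ⟨⟨k, π, hπ⟩, rfl⟩
      exact ⟨k, π, hπ, rfl⟩
  rw [this]
  refine Measurable.iSup fun z => ?_
  refine Finset.measurable_sum _ fun i _ => hS.comp ?_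
  fun_prop

lemma expLV_eq {A : Type*} [MeasurableSpace A] (p : Measure A) [IsProbabilityMeasure p]
    {m : ℕ} {ι : Type*} [Fintype ι] (ℓ : Fin m → ℕ) (S : (Fin m → A) → ℝ) (hS : Measurable S)
    (e : ∀ j, Fin (ℓ j) → ι)
    (he : Function.Injective (fun x : Σ j, Fin (ℓ j) => e x.1 x.2)) :
    expLV p ℓ S = ∫ W, optScoreV m ℓ S (fun j i => W (e j i)) ∂(Measure.pi fun _ : ι => p) := by
  have h := map_words p ℓ e he
  rw [expLV, ← h.map_eq, integral_map h.measurable.aemeasurable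
    (measurable_optV ℓ S hS).aestronglyMeasurable]

lemma optV_add {A : Type*} {m : ℕ} (hm : 0 < m) (ℓ ℓ' : Fin m → ℕ) (S : (Fin m → A) → ℝ)
    (sStar : ℝ) (hSb : ∀ x, S x ≤ sStar) (w : ∀ j : Fin m, Fin (ℓ j + ℓ' j) → A) :
    optScoreV m ℓ S (fun j i => w j (Fin.castAdd _ i)) +
      optScoreV m ℓ' S (fun j i => w j (Fin.natAdd _ i)) ≤
      optScoreV m (fun j => ℓ j + ℓ' j) S w := by
  rw [← le_sub_iff_add_le]
  refine optV_le _ _ _ _ fun k π hπ => ?_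
  rw [le_sub_comm]
  refine optV_le _ _ _ _ fun k' π' hπ' => ?_
  rw [le_sub_iff_add_le, add_comm]
  have := le_optV hm (fun j => ℓ j + ℓ' j) S sStar hSb w (k + k')
    (fun j => Fin.append (fun i => Fin.castAdd _ (π j i)) (fun i => Fin.natAdd _ (π' j i))) ?_
  · rw [Fin.sum_univ_add] at this
    simpa using this
  · intro j a b hab
    induction a using Fin.addCases with
    | left a =>
      induction b using Fin.addCases with
      | left b =>
        have h1 : a < b := by
          rw [Fin.lt_def] at hab ⊢; exact hab
        have h2 := hπ j h1
        rw [Fin.lt_def] at h2 ⊢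
        simpa only [Fin.append_left, Fin.val_castAdd] using h2
      | right b =>
        rw [Fin.lt_def]
        simp only [Fin.append_left, Fin.append_right, Fin.val_castAdd, Fin.val_natAdd]
        omega
    | right a =>
      induction b using Fin.addCases with
      | left b =>
        rw [Fin.lt_def] at hab
        simp only [Fin.val_castAdd, Fin.val_natAdd] at hab
        omega
      | right b =>
        have h1 : a < b := by
          rw [Fin.lt_def] at hab ⊢
          simpa only [Fin.val_natAdd, Nat.add_lt_add_iff_left] using hab
        have h2 := hπ' j h1
        rw [Fin.lt_def] at h2 ⊢
        simpa only [Fin.append_right, Fin.val_natAdd, Nat.add_lt_add_iff_left] using h2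

lemma optV_perm {A : Type*} {m : ℕ} (hm : 0 < m) (ℓ : Fin m → ℕ) (S : (Fin m → A) → ℝ)
    (sStar : ℝ) (hSb : ∀ x, S x ≤ sStar) (hSperm : PermInvariant S) (σ : Equiv.Perm (Fin m))
    (w : ∀ j : Fin m, Fin (ℓ j) → A) :
    optScoreV m ℓ S w ≤ optScoreV m (fun j => ℓ (σ j)) S (fun j => w (σ j)) := by
  refine optV_le _ _ _ _ fun k π hπ => ?_
  have := le_optV hm (fun j => ℓ (σ j)) S sStar hSb (fun j => w (σ j)) k (fun j => π (σ j))
    (fun j => hπ _)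
  refine le_trans (le_of_eq ?_) this
  refine Finset.sum_congr rfl fun i _ => ?_
  exact (hSperm σ (fun j => w j (π j i))).symm

lemma optV_diff {A : Type*} {m : ℕ} (hm : 0 < m) (ℓ : Fin m → ℕ) (S : (Fin m → A) → ℝ)
    (sStar : ℝ) (hSb : ∀ x, S x ≤ sStar) (D : ℝ) (hD0 : 0 < D) (hBD : BddDiffOne S D)
    (w w' : ∀ j : Fin m, Fin (ℓ j) → A) (j0 : Fin m) (i0 : ℕ)
    (hw : ∀ j (i : Fin (ℓ j)), (j ≠ j0 ∨ (i : ℕ) ≠ i0) → w j i = w' j i) :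
    optScoreV m ℓ S w ≤ optScoreV m ℓ S w' + D := by
  refine optV_le _ _ _ _ fun k π hπ => ?_
  have h1 := le_optV hm ℓ S sStar hSb w' k π hπ
  suffices h : ∑ i : Fin k, S (fun j => w j (π j i)) - ∑ i : Fin k, S (fun j => w' j (π j i)) ≤ D by
    linarith
  rw [← Finset.sum_sub_distrib]
  have hne : ∀ i, ((π j0 i : ℕ) ≠ i0) →
      S (fun j => w j (π j i)) - S (fun j => w' j (π j i)) = 0 := by
    intro i hi
    rw [sub_eq_zero]
    congr 1; ext j
    apply hw
    by_cases h : j = j0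
    · subst h; exact Or.inr hi
    · exact Or.inl h
  by_cases hex : ∃ i1, (π j0 i1 : ℕ) = i0
  · obtain ⟨i1, hi1⟩ := hex
    rw [Finset.sum_eq_single i1]
    · refine (le_abs_self _).trans (hBD _ _ ⟨j0, fun j hj => hw _ _ (Or.inl hj)⟩)
    · intro i _ hi
      apply hne
      intro h
      apply hi
      apply (hπ j0).injective
      apply Fin.ext
      rw [h, hi1]
    · simp
  · push Not at hex
    rw [Finset.sum_eq_zero fun i _ => hne i (hex i)]
    exact hD0.le

lemma expLV_add {A : Type*} [Finite A] [MeasurableSpace A] (p : Measure A) [IsProbabilityMeasure p]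
    {m : ℕ} (hm : 0 < m) (ℓ ℓ' : Fin m → ℕ) (S : (Fin m → A) → ℝ) (hS : Measurable S)
    (sStar : ℝ) (hSb : ∀ x, S x ≤ sStar) :
    expLV p ℓ S + expLV p ℓ' S ≤ expLV p (fun j => ℓ j + ℓ' j) S := by
  rw [expLV_eq p (ι := Σ j, Fin (ℓ j + ℓ' j)) ℓ S hS (fun j i => ⟨j, Fin.castAdd _ i⟩),
    expLV_eq p (ι := Σ j, Fin (ℓ j + ℓ' j)) ℓ' S hS (fun j i => ⟨j, Fin.natAdd _ i⟩),
    expLV_eq p (ι := Σ j, Fin (ℓ j + ℓ' j)) _ S hS (fun j i => ⟨j, i⟩), ← integral_add]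
  · refine integral_mono ?_ ?_ fun W => optV_add hm ℓ ℓ' S sStar hSb (fun j i => W ⟨j, i⟩)
    · refine integrable_fin _ (Measurable.add ?_ ?_)
      · exact (measurable_optV ℓ S hS).comp (by fun_prop)
      · exact (measurable_optV ℓ' S hS).comp (by fun_prop)
    · refine integrable_fin _ ?_
      exact (measurable_optV _ S hS).comp (by fun_prop)
  · exact integrable_fin _ ((measurable_optV ℓ S hS).comp (by fun_prop))
  · exact integrable_fin _ ((measurable_optV ℓ' S hS).comp (by fun_prop))
  · rintro ⟨j, i⟩ ⟨j', i'⟩ h; simpa using h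
  · rintro ⟨j, i⟩ ⟨j', i'⟩ h
    simp only [Sigma.mk.injEq] at h
    obtain ⟨rfl, h⟩ := h
    simpa using h
  · rintro ⟨j, i⟩ ⟨j', i'⟩ h
    simp only [Sigma.mk.injEq] at h
    obtain ⟨rfl, h⟩ := h
    simpa using h

lemma expLV_perm {A : Type*} [Finite A] [MeasurableSpace A] (p : Measure A)
    [IsProbabilityMeasure p]
    {m : ℕ} (hm : 0 < m) (ℓ : Fin m → ℕ) (S : (Fin m → A) → ℝ) (hS : Measurable S)
    (sStar : ℝ) (hSb : ∀ x, S x ≤ sStar) (hSperm : PermInvariant S) (σ : Equiv.Perm (Fin m)) :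
    expLV p ℓ S ≤ expLV p (fun j => ℓ (σ j)) S := by
  rw [expLV_eq p (ι := Σ j, Fin (ℓ j)) ℓ S hS (fun j i => ⟨j, i⟩),
    expLV_eq p (ι := Σ j, Fin (ℓ j)) _ S hS (fun j i => ⟨σ j, i⟩)]
  · refine integral_mono ?_ ?_ fun W => optV_perm hm ℓ S sStar hSb hSperm σ (fun j i => W ⟨j, i⟩)
    · exact integrable_fin _ ((measurable_optV _ S hS).comp (by fun_prop))
    · exact integrable_fin _ ((measurable_optV _ S hS).comp (by fun_prop))
  · rintro ⟨j, i⟩ ⟨j', i'⟩ h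
    simp only [Sigma.mk.injEq] at h
    obtain ⟨h1, h⟩ := h
    have := σ.injective h1
    subst this
    simpa using h
  · rintro ⟨j, i⟩ ⟨j', i'⟩ h; simpa using h

lemma expLV_nonneg {A : Type*} [MeasurableSpace A] (p : Measure A)
    {m : ℕ} (hm : 0 < m) (ℓ : Fin m → ℕ) (S : (Fin m → A) → ℝ)
    (sStar : ℝ) (hSb : ∀ x, S x ≤ sStar) : 0 ≤ expLV p ℓ S := by
  refine integral_nonneg fun w => ?_
  simpa using le_optV hm ℓ S sStar hSb w 0 (fun _ i => i.elim0) (fun _ i => i.elim0)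

lemma expLV_sum {A : Type*} [Finite A] [MeasurableSpace A] (p : Measure A)
    [IsProbabilityMeasure p]
    {m : ℕ} (hm : 0 < m) (S : (Fin m → A) → ℝ) (hS : Measurable S)
    (sStar : ℝ) (hSb : ∀ x, S x ≤ sStar) {κ : Type*} (T : Finset κ) (L : κ → Fin m → ℕ) :
    ∑ s ∈ T, expLV p (L s) S ≤ expLV p (fun j => ∑ s ∈ T, L s j) S := by
  classical
  induction T using Finset.induction_on with
  | empty => simpa using expLV_nonneg p hm _ S sStar hSb
  | insert a T ha ih =>
    rw [Finset.sum_insert ha]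
    have := expLV_add p hm (L a) (fun j => ∑ s ∈ T, L s j) S hS sStar hSb
    simp only [Finset.sum_insert ha]
    linarith

lemma expLV_mul {A : Type*} [Finite A] [MeasurableSpace A] (p : Measure A)
    [IsProbabilityMeasure p]
    {m : ℕ} (hm : 0 < m) (S : (Fin m → A) → ℝ) (hS : Measurable S)
    (sStar : ℝ) (hSb : ∀ x, S x ≤ sStar) (N : ℕ) (ℓ : Fin m → ℕ) :
    N * expLV p ℓ S ≤ expLV p (fun j => N * ℓ j) S := by
  simpa using expLV_sum p hm S hS sStar hSb (Finset.range N) (fun _ => ℓ)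

lemma expLV_rot {A : Type*} [Finite A] [MeasurableSpace A] (p : Measure A)
    [IsProbabilityMeasure p]
    {m : ℕ} (hm : 0 < m) (S : (Fin m → A) → ℝ) (hS : Measurable S)
    (sStar : ℝ) (hSb : ∀ x, S x ≤ sStar) (hSperm : PermInvariant S) (ℓ : Fin m → ℕ) :
    m * expLV p ℓ S ≤ expL p m (∑ j, ℓ j) S := by
  have : NeZero m := ⟨hm.ne'⟩
  have h1 := expLV_sum p hm S hS sStar hSb Finset.univ
    (fun (s : Fin m) j => ℓ (Equiv.addLeft j s))
  have h2 : ∀ s : Fin m, expLV p ℓ S ≤ expLV p (fun j => ℓ (Equiv.addLeft j s)) S := fun s => by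
    have := expLV_perm p hm ℓ S hS sStar hSb hSperm (Equiv.addRight s)
    simpa using this
  have h3 : (m : ℝ) * expLV p ℓ S ≤ ∑ s : Fin m, expLV p (fun j => ℓ (Equiv.addLeft j s)) S := by
    calc (m : ℝ) * expLV p ℓ S = ∑ s : Fin m, expLV p ℓ S := by simp
      _ ≤ _ := Finset.sum_le_sum fun s _ => h2 s
  have h4 : ∀ j : Fin m, ∑ s, ℓ (Equiv.addLeft j s) = ∑ j, ℓ j := fun j =>
    Equiv.sum_comp (Equiv.addLeft j) ℓ
  simp only [h4] at h1
  exact h3.trans h1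

lemma expL_le {A : Type*} [Finite A] [MeasurableSpace A] (p : Measure A)
    [IsProbabilityMeasure p]
    {m : ℕ} (hm : 0 < m) (S : (Fin m → A) → ℝ) (hS : Measurable S)
    (sStar : ℝ) (hSb : ∀ x, S x ≤ sStar) (γ : ℝ)
    (hγ : Tendsto (fun n : ℕ => expL p m n S / n) atTop (nhds γ)) (n : ℕ) :
    expL p m n S ≤ γ * n := by
  have hmul : ∀ N : ℕ, N * expL p m n S ≤ expL p m (N * n) S := fun N =>
    expLV_mul p hm S hS sStar hSb N (fun _ => n)
  rcases Nat.eq_zero_or_pos n with rfl | hn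
  · have := hmul 2
    simp at this ⊢
    linarith
  · have hn' : (0 : ℝ) < n := by exact_mod_cast hn
    have ht : Tendsto (fun N : ℕ => N * n) atTop atTop :=
      tendsto_id.atTop_mul_const' hn
    have h := hγ.comp ht
    have h2 : expL p m n S / n ≤ γ := by
      refine ge_of_tendsto h ?_
      filter_upwards [eventually_gt_atTop 0] with N hN
      have hN' : (0 : ℝ) < N := by exact_mod_cast hN
      have := hmul N
      simp only [Function.comp]
      push_cast
      rw [div_le_div_iff₀ hn' (by positivity)]
      nlinarith
    rwa [div_le_iff₀ hn'] at h2

lemma expLV_le {A : Type*} [Finite A] [MeasurableSpace A] (p : Measure A)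
    [IsProbabilityMeasure p]
    {m : ℕ} (hm : 0 < m) (S : (Fin m → A) → ℝ) (hS : Measurable S)
    (sStar : ℝ) (hSb : ∀ x, S x ≤ sStar) (hSperm : PermInvariant S) (γ : ℝ)
    (hγ : Tendsto (fun n : ℕ => expL p m n S / n) atTop (nhds γ)) (ℓ : Fin m → ℕ) :
    expLV p ℓ S ≤ γ * (∑ j, (ℓ j : ℝ)) / m := by
  have h1 := expLV_rot p hm S hS sStar hSb hSperm ℓ
  have h2 := expL_le p hm S hS sStar hSb γ hγ (∑ j, ℓ j)
  have hm' : (0 : ℝ) < m := by exact_mod_cast hm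
  rw [le_div_iff₀ hm']
  push_cast at h2
  linarith

lemma expLV_le_g {A : Type*} [Finite A] [MeasurableSpace A] (p : Measure A)
    [IsProbabilityMeasure p]
    {m : ℕ} (hm : 0 < m) (S : (Fin m → A) → ℝ) (hS : Measurable S)
    (sStar : ℝ) (hSb : ∀ x, S x ≤ sStar) (ℓ : Fin m → ℕ) (hℓ : ∀ j, 0 < ℓ j) (G : ℝ)
    (hG : Tendsto (fun n : ℕ => expLV p (fun j => ⌈(n : ℝ) * ((ℓ j : ℝ) / ℓ ⟨0, hm⟩)⌉₊) S /
        ((n : ℝ) * (∑ j, (ℓ j : ℝ) / ℓ ⟨0, hm⟩) / m)) atTop (nhds G)) :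
    expLV p ℓ S ≤ G * (∑ j, (ℓ j : ℝ)) / m := by
  have hm' : (0 : ℝ) < m := by exact_mod_cast hm
  have h0 : (0 : ℝ) < ℓ ⟨0, hm⟩ := by exact_mod_cast hℓ _
  have hs : (0 : ℝ) < ∑ j, (ℓ j : ℝ) :=
    Finset.sum_pos (fun j _ => by exact_mod_cast hℓ j) ⟨⟨0, hm⟩, Finset.mem_univ _⟩
  have ht : Tendsto (fun N : ℕ => N * ℓ ⟨0, hm⟩) atTop atTop :=
    tendsto_id.atTop_mul_const' (hℓ _)
  have h := hG.comp ht
  have h2 : expLV p ℓ S / ((∑ j, (ℓ j : ℝ)) / m) ≤ G := by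
    refine ge_of_tendsto h ?_
    filter_upwards [eventually_gt_atTop 0] with N hN
    have hN' : (0 : ℝ) < N := by exact_mod_cast hN
    have := expLV_mul p hm S hS sStar hSb N ℓ
    simp only [Function.comp]
    have hc : ∀ j, ⌈((N * ℓ ⟨0, hm⟩ : ℕ) : ℝ) * ((ℓ j : ℝ) / ℓ ⟨0, hm⟩)⌉₊ = N * ℓ j := by
      intro j
      rw [show ((N * ℓ ⟨0, hm⟩ : ℕ) : ℝ) * ((ℓ j : ℝ) / ℓ ⟨0, hm⟩) = ((N * ℓ j : ℕ) : ℝ) by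
        push_cast; field_simp]
      exact Nat.ceil_natCast _
    simp only [hc]
    have hd : ((N * ℓ ⟨0, hm⟩ : ℕ) : ℝ) * (∑ j, (ℓ j : ℝ) / ℓ ⟨0, hm⟩) / m
        = N * ((∑ j, (ℓ j : ℝ)) / m) := by
      rw [← Finset.sum_div]; push_cast; field_simp
    rw [hd, div_le_div_iff₀ (by positivity) (by positivity)]
    have hsm : 0 < (∑ j, (ℓ j : ℝ)) / m := by positivity
    nlinarith
  rw [div_le_iff₀ (by positivity)] at h2
  rw [mul_div_assoc]; exact h2

noncomputable def cutOne {A : Type*} {m n : ℕ} (S : (Fin m → A) → ℝ) (s : Fin m → Fin n)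
    (w : Fin m → Fin n → A) : ℝ :=
  optScoreV m (fun j => (s j : ℕ) + 1) S (fun j x => w j ⟨x, by have := (s j).2; omega⟩)

noncomputable def cutTwo {A : Type*} {m n : ℕ} (S : (Fin m → A) → ℝ) (s : Fin m → Fin n)
    (w : Fin m → Fin n → A) : ℝ :=
  optScoreV m (fun j => n - ((s j : ℕ) + 1)) S
    (fun j x => w j ⟨(s j : ℕ) + 1 + x, by have := (s j).2; omega⟩)

noncomputable def cutGap {A : Type*} {m n : ℕ} (S : (Fin m → A) → ℝ) (s : Fin m → Fin n)
    (w : Fin m → Fin n → A) : ℝ :=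
  cutOne S s w + cutTwo S s w - optScoreV m (fun _ => n) S w

lemma cut_split {A : Type*} {m n : ℕ} (hm : 0 < m) (S : (Fin m → A) → ℝ)
    (sStar : ℝ) (hSb : ∀ x, S x ≤ sStar) (w : Fin m → Fin n → A)
    (k : ℕ) (π : Fin m → Fin k → Fin n) (hπ : ∀ j, StrictMono (π j)) (i : Fin k) :
    alignScore S w π ≤ cutOne S (fun j => π j i) w + cutTwo S (fun j => π j i) w := by
  obtain ⟨i, hi⟩ := i
  obtain ⟨b, rfl⟩ := Nat.exists_eq_add_of_le (Nat.succ_le_of_lt hi)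
  rw [alignScore, Fin.sum_univ_add]
  refine add_le_add ?_ ?_
  · have hle : ∀ j (x : Fin (i + 1)), (π j (Fin.castAdd b x) : ℕ) < (π j ⟨i, hi⟩ : ℕ) + 1 := by
      intro j x
      have : π j (Fin.castAdd b x) ≤ π j ⟨i, hi⟩ := (hπ j).monotone (by
        rw [Fin.le_def]; have := x.2; simp only [Fin.val_castAdd]; omega)
      rw [Fin.le_def] at this
      omega
    exact le_optV hm (fun j => (π j ⟨i, hi⟩ : ℕ) + 1) S sStar hSb
      (fun j x => w j ⟨x, by have := (π j ⟨i, hi⟩).2; omega⟩) (i + 1)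
      (fun j x => ⟨π j (Fin.castAdd b x), hle j x⟩)
      (fun j x y hxy => by
        rw [Fin.lt_def]
        exact hπ j (show Fin.castAdd b x < Fin.castAdd b y from hxy))
  · have hle : ∀ j (x : Fin b), (π j ⟨i, hi⟩ : ℕ) + 1 ≤ (π j (Fin.natAdd (i + 1) x) : ℕ) := by
      intro j x
      have : π j ⟨i, hi⟩ < π j (Fin.natAdd (i + 1) x) := hπ j (by
        rw [Fin.lt_def]; simp only [Fin.val_natAdd]; omega)
      rw [Fin.lt_def] at this
      omega
    have h := le_optV hm (fun j => n - ((π j ⟨i, hi⟩ : ℕ) + 1)) S sStar hSb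
      (fun j x => w j ⟨(π j ⟨i, hi⟩ : ℕ) + 1 + x, by have := (π j ⟨i, hi⟩).2; omega⟩) b
      (fun j x => ⟨(π j (Fin.natAdd (i + 1) x) : ℕ) - ((π j ⟨i, hi⟩ : ℕ) + 1), by
        have := hle j x; have := (π j (Fin.natAdd (i + 1) x)).2; omega⟩)
      (fun j x y hxy => by
        have h1 : π j (Fin.natAdd (i + 1) x) < π j (Fin.natAdd (i + 1) y) := hπ j (by
          rw [Fin.lt_def] at *; simp only [Fin.val_natAdd]; omega)
        rw [Fin.lt_def] at *
        have := hle j x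
        simp only
        omega)
    refine le_trans (le_of_eq ?_) h
    refine Finset.sum_congr rfl fun x _ => ?_
    congr 1; ext j; congr 1
    apply Fin.ext
    exact (Nat.add_sub_of_le (hle j x)).symm

lemma cut_diff {A : Type*} {m n : ℕ} (hm : 0 < m) (S : (Fin m → A) → ℝ)
    (sStar : ℝ) (hSb : ∀ x, S x ≤ sStar) (D : ℝ) (hD0 : 0 < D) (hBD : BddDiffOne S D)
    (s : Fin m → Fin n) (w w' : Fin m → Fin n → A) (j0 : Fin m) (i0 : ℕ)
    (hw : ∀ j (i : Fin n), (j ≠ j0 ∨ (i : ℕ) ≠ i0) → w j i = w' j i) :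
    cutOne S s w + cutTwo S s w ≤ cutOne S s w' + cutTwo S s w' + D := by
  by_cases h : i0 < (s j0 : ℕ) + 1
  · have h2 : cutTwo S s w = cutTwo S s w' := by
      unfold cutTwo
      congr 1; ext j x
      apply hw
      by_cases hj : j = j0
      · subst hj; right; simp only; omega
      · exact Or.inl hj
    have h1 : cutOne S s w ≤ cutOne S s w' + D :=
      optV_diff hm _ S sStar hSb D hD0 hBD _ _ j0 i0 (fun j x hx => hw _ _ hx)
    linarith
  · have h2 : cutOne S s w = cutOne S s w' := by
      unfold cutOne
      congr 1; ext j x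
      apply hw
      by_cases hj : j = j0
      · subst hj; right; have := x.2; simp only; omega
      · exact Or.inl hj
    have h1 : cutTwo S s w ≤ cutTwo S s w' + D :=
      optV_diff hm _ S sStar hSb D hD0 hBD _ _ j0 (i0 - ((s j0 : ℕ) + 1)) (fun j x hx => by
        apply hw
        by_cases hj : j = j0
        · subst hj
          rcases hx with hx | hx
          · exact absurd rfl hx
          · right; simp only; omega
        · exact Or.inl hj)
    linarith

lemma gap_diff {A : Type*} {m n : ℕ} (hm : 0 < m) (S : (Fin m → A) → ℝ)
    (sStar : ℝ) (hSb : ∀ x, S x ≤ sStar) (D : ℝ) (hD0 : 0 < D) (hBD : BddDiffOne S D)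
    (s : Fin m → Fin n) (w w' : Fin m → Fin n → A) (j0 : Fin m) (i0 : ℕ)
    (hw : ∀ j (i : Fin n), (j ≠ j0 ∨ (i : ℕ) ≠ i0) → w j i = w' j i) :
    |cutGap S s w - cutGap S s w'| ≤ 2 * D := by
  have hw' : ∀ j (i : Fin n), (j ≠ j0 ∨ (i : ℕ) ≠ i0) → w' j i = w j i :=
    fun j i h => (hw j i h).symm
  have h1 := cut_diff hm S sStar hSb D hD0 hBD s w w' j0 i0 hw
  have h2 := cut_diff hm S sStar hSb D hD0 hBD s w' w j0 i0 hw'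
  have h3 := optV_diff hm (fun _ => n) S sStar hSb D hD0 hBD w w' j0 i0 hw
  have h4 := optV_diff hm (fun _ => n) S sStar hSb D hD0 hBD w' w j0 i0 hw'
  unfold cutGap
  rw [abs_le]
  constructor <;> linarith

lemma gap_measurable {A : Type*} [MeasurableSpace A] {m n : ℕ} (S : (Fin m → A) → ℝ)
    (hS : Measurable S) (s : Fin m → Fin n) : Measurable (cutGap S s) := by
  refine Measurable.sub (Measurable.add ?_ ?_) (measurable_optV _ S hS)
  · exact (measurable_optV _ S hS).comp (by fun_prop)
  · exact (measurable_optV _ S hS).comp (by fun_prop)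

lemma gap_prob {A : Type*} [Finite A] [MeasurableSpace A] (p : Measure A)
    [IsProbabilityMeasure p] {m n : ℕ} (hm : 0 < m) (hn : 0 < n) (S : (Fin m → A) → ℝ)
    (hS : Measurable S)
    (sStar : ℝ) (hSb : ∀ x, S x ≤ sStar) (D : ℝ) (hD0 : 0 < D) (hBD : BddDiffOne S D)
    (s : Fin m → Fin n) (t : ℝ) (ht : 0 < t)
    (hE : expLV p (fun j => (s j : ℕ) + 1) S + expLV p (fun j => n - ((s j : ℕ) + 1)) S
      - expL p m n S ≤ -t) :
    (wordMeasure p m n).real {w | 0 ≤ cutGap S s w}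
      ≤ Real.exp (-2 * t ^ 2 / ((m * n : ℕ) * (2 * D) ^ 2)) := by
  set e : Fin m → Fin n → Fin (m * n) := fun j i => finProdFinEquiv (j, i) with he
  have hinj : ∀ j i j' i', e j i = e j' i' → j = j' ∧ i = i' := by
    intro j i j' i' h
    have := finProdFinEquiv.injective h
    simpa using this
  have hinj' : Function.Injective (fun x : Σ _ : Fin m, Fin n => e x.1 x.2) := by
    rintro ⟨j, i⟩ ⟨j', i'⟩ h
    obtain ⟨rfl, rfl⟩ := hinj _ _ _ _ h
    rfl
  have hmp := map_words p (ι := Fin (m * n)) (fun _ : Fin m => n) e hinj'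
  have hmeas := gap_measurable S hS s
  have hset : MeasurableSet {w | 0 ≤ cutGap S s w} := measurableSet_le measurable_const hmeas
  have h1 : (wordMeasure p m n).real {w | 0 ≤ cutGap S s w}
      = (Measure.pi fun _ : Fin (m * n) => p).real
        {W | 0 ≤ cutGap S s (fun j i => W (e j i))} := by
    rw [measureReal_def, measureReal_def]
    congr 1
    exact (hmp.measure_preimage hset.nullMeasurableSet).symm
  rw [h1]
  refine mcdiarmid p (2 * D) t (by positivity) ht (m * n) (Nat.mul_pos hm hn)
    (fun W => cutGap S s (fun j i => W (e j i))) (hmeas.comp hmp.measurable) ?_ ?_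
  · intro x z a
    obtain ⟨⟨j0, i0⟩, rfl⟩ := finProdFinEquiv.surjective z
    refine gap_diff hm S sStar hSb D hD0 hBD s _ _ j0 (i0 : ℕ) ?_
    intro j i h
    rw [Function.update_of_ne]
    intro hh
    obtain ⟨rfl, rfl⟩ := hinj _ _ _ _ hh
    simp at h
  · refine le_trans (le_of_eq ?_) hE
    have e1 := expLV_eq p (ι := Fin (m * n)) (fun j => (s j : ℕ) + 1) S hS
      (fun j x => e j ⟨x, by have := (s j).2; omega⟩) (by
        rintro ⟨j, i⟩ ⟨j', i'⟩ h
        obtain ⟨rfl, h⟩ := hinj _ _ _ _ h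
        simp only [Fin.mk.injEq] at h
        have := Fin.ext h
        subst this; rfl)
    have e2 := expLV_eq p (ι := Fin (m * n)) (fun j => n - ((s j : ℕ) + 1)) S hS
      (fun j x => e j ⟨(s j : ℕ) + 1 + x, by have := (s j).2; omega⟩) (by
        rintro ⟨j, i⟩ ⟨j', i'⟩ h
        obtain ⟨rfl, h⟩ := hinj _ _ _ _ h
        simp only [Fin.mk.injEq] at h
        have := Fin.ext (Nat.add_left_cancel h)
        subst this; rfl)
    have e3 := expLV_eq p (ι := Fin (m * n)) (fun _ => n) S hS e hinj'
    have e3' : expL p m n S = expLV p (fun _ => n) S := rfl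
    rw [e3', e1, e2, e3]
    unfold cutGap
    have i1 : Integrable (fun W : Fin (m * n) → A => cutOne S s (fun j i => W (e j i)))
      (Measure.pi fun _ => p) :=
      integrable_fin _ ((measurable_optV _ S hS).comp (by fun_prop))
    have i2 : Integrable (fun W : Fin (m * n) → A => cutTwo S s (fun j i => W (e j i)))
      (Measure.pi fun _ => p) :=
      integrable_fin _ ((measurable_optV _ S hS).comp (by fun_prop))
    have i3 : Integrable (fun W : Fin (m * n) → A =>
        optScoreV m (fun _ => n) S (fun j i => W (e j i))) (Measure.pi fun _ => p) :=
      integrable_fin _ ((measurable_optV _ S hS).comp (by fun_prop))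
    have j1 := integral_sub (i1.add i2) i3
    have j2 := integral_add i1 i2
    simp only [Pi.add_apply] at j1
    rw [j2] at j1
    exact j1

lemma main_meas
    {A : Type*} [Finite A] [MeasurableSpace A]
    (p : Measure A) [IsProbabilityMeasure p]
    (m : ℕ) (hm0 : 0 < m) (S : (Fin m → A) → ℝ) (hS : Measurable S)
    (sStar : ℝ) (hSb : ∀ x, S x ≤ sStar) (hSperm : PermInvariant S)
    (D : ℝ) (hD0 : 0 < D) (hBD : BddDiffOne S D)
    (γ δStar : ℝ)
    (hγ : Tendsto (fun n : ℕ => expL p m n S / n) atTop (nhds γ))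
    (g : (Fin m → ℝ) → ℝ)
    (hg : ∀ q : Fin m → ℝ, (∀ j, 0 < q j) → q ⟨0, hm0⟩ = 1 →
      Tendsto (fun n : ℕ => expLV p (fun j => ⌈(n : ℝ) * q j⌉₊) S /
        ((n : ℝ) * (∑ j, q j) / m)) atTop (nhds (g q)))
    (p1 p2 : Fin m → ℝ)
    (hp : ∀ j : Fin m, (j : ℕ) ≠ 0 → 0 < p1 j ∧ p1 j < 1 ∧ 1 < p2 j)
    (hoff : ∀ q : Fin m → ℝ, (∀ j, 0 < q j) → q ⟨0, hm0⟩ = 1 →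
      (∃ j : Fin m, (j : ℕ) ≠ 0 ∧ (q j < p1 j ∨ p2 j < q j)) → g q ≤ δStar)
    (η ε : ℝ) (hη : 0 < η ∧ η < γ - δStar) (hε : 0 < ε)
    (v : ℕ) (κ : ℝ) (hκ : 0 < κ) :
    ∃ N : ℕ, ∀ n : ℕ, N ≤ n →
      1 - Real.exp (-(n : ℝ) * (-κ + η ^ 2 * ε ^ 2 / (2 * (m : ℝ) ^ 3 * D ^ 2))) ≤
        ((wordMeasure p m n) {w | ∀ (k : ℕ) (π : Fin m → Fin k → Fin n),
          (∀ j, StrictMono (π j)) → alignScore S w π = optScore m n S w →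
          ∀ (i : Fin k) (j : Fin m), (j : ℕ) ≠ 0 →
            p1 j * (((π ⟨0, hm0⟩ i : ℕ) : ℝ) + 1) - p1 j * n * ε - p1 j * v ≤
                ((π j i : ℕ) : ℝ) + 1 ∧
            ((π j i : ℕ) : ℝ) + 1 ≤
                p2 j * (((π ⟨0, hm0⟩ i : ℕ) : ℝ) + 1) + p2 j * n * ε + p2 j * v}).toReal := by
  have hm' : (0 : ℝ) < m := by exact_mod_cast hm0
  have hgap : γ - (γ - δStar - η) * ε / m < γ := by
    have : 0 < (γ - δStar - η) * ε / m := by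
      apply div_pos (mul_pos (by linarith [hη.2]) hε) hm'
    linarith
  have ev1 : ∀ᶠ n : ℕ in atTop, γ - (γ - δStar - η) * ε / m < expL p m n S / n :=
    hγ.eventually_const_lt hgap
  have ev2 : ∀ᶠ n : ℕ in atTop, ((n : ℝ) ^ m) * Real.exp (-κ * n) < 1 := by
    have h := (tendsto_rpow_mul_exp_neg_mul_atTop_nhds_zero (m : ℝ) κ hκ).comp
      (tendsto_natCast_atTop_atTop (R := ℝ))
    have h2 := h.eventually_lt_const (zero_lt_one)
    filter_upwards [h2] with n hn
    simpa using hn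
  obtain ⟨N, hN⟩ := eventually_atTop.1 ((ev1.and ev2).and (eventually_gt_atTop 0))
  refine ⟨N, fun n hn => ?_⟩
  obtain ⟨⟨h1, h2⟩, hn0⟩ := hN n hn
  have hn' : (0 : ℝ) < n := by exact_mod_cast hn0
  set K : ℝ := η ^ 2 * ε ^ 2 / (2 * (m : ℝ) ^ 3 * D ^ 2) with hK
  set E := {w : Fin m → Fin n → A | ∀ (k : ℕ) (π : Fin m → Fin k → Fin n),
          (∀ j, StrictMono (π j)) → alignScore S w π = optScore m n S w →
          ∀ (i : Fin k) (j : Fin m), (j : ℕ) ≠ 0 →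
            p1 j * (((π ⟨0, hm0⟩ i : ℕ) : ℝ) + 1) - p1 j * n * ε - p1 j * v ≤
                ((π j i : ℕ) : ℝ) + 1 ∧
            ((π j i : ℕ) : ℝ) + 1 ≤
                p2 j * (((π ⟨0, hm0⟩ i : ℕ) : ℝ) + 1) + p2 j * n * ε + p2 j * v} with hEdef
  set μ := wordMeasure p m n with hμ
  have : IsProbabilityMeasure μ := by rw [hμ, wordMeasure]; infer_instance
  classical
  set bad : Finset (Fin m → Fin n) := Finset.univ.filter fun s => ∃ j : Fin m, (j : ℕ) ≠ 0 ∧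
    (((s j : ℕ) : ℝ) + 1 <
      p1 j * (((s ⟨0, hm0⟩ : ℕ) : ℝ) + 1) - p1 j * n * ε - p1 j * v ∨
     p2 j * (((s ⟨0, hm0⟩ : ℕ) : ℝ) + 1) + p2 j * n * ε + p2 j * v < ((s j : ℕ) : ℝ) + 1)
    with hbad
  have hsub : Eᶜ ⊆ ⋃ s ∈ bad, {w | 0 ≤ cutGap S s w} := by
    intro w hw
    rw [Set.mem_compl_iff, hEdef, Set.mem_ofPred_eq] at hw
    push Not at hw
    obtain ⟨k, π, hπ, hopt, i, j, hj, hlt⟩ := hw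
    simp only [Set.mem_iUnion]
    refine ⟨fun j => π j i, ?_, ?_⟩
    · simp only [hbad, Finset.mem_filter, Finset.mem_univ, true_and]
      refine ⟨j, hj, ?_⟩
      by_cases hc : p1 j * (((π ⟨0, hm0⟩ i : ℕ) : ℝ) + 1) - p1 j * n * ε - p1 j * v ≤
                ((π j i : ℕ) : ℝ) + 1
      · exact Or.inr (hlt hc)
      · exact Or.inl (not_le.1 hc)
    · have hs := cut_split hm0 S sStar hSb w k π hπ i
      rw [hopt] at hs
      have hs2 : optScore m n S w = optScoreV m (fun _ => n) S w := rfl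
      rw [hs2] at hs
      simp only [Set.mem_ofPred_eq, cutGap]
      linarith
  have hone : ∀ s ∈ bad, μ.real {w | 0 ≤ cutGap S s w} ≤ Real.exp (-(n : ℝ) * K) := by
    intro s hs
    simp only [hbad, Finset.mem_filter, Finset.mem_univ, true_and] at hs
    obtain ⟨j, hj, hs⟩ := hs
    obtain ⟨hp1, hp1', hp2⟩ := hp j hj
    set T : ℝ := ∑ j, (((s j : ℕ) + 1 : ℕ) : ℝ) with hT
    have hle : ∀ i, (((s i : ℕ) + 1 : ℕ) : ℝ) ≤ T := fun i =>
      Finset.single_le_sum (f := fun j => (((s j : ℕ) + 1 : ℕ) : ℝ))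
        (fun _ _ => Nat.cast_nonneg _) (Finset.mem_univ i)
    have hv0 : (0 : ℝ) ≤ v := Nat.cast_nonneg _
    have hsj : (0 : ℝ) < ((s j : ℕ) : ℝ) + 1 := by positivity
    have hs0 : (0 : ℝ) < ((s ⟨0, hm0⟩ : ℕ) : ℝ) + 1 := by positivity
    have hnε : 0 < n * ε := by positivity
    have hTn : n * ε ≤ T ∧ ((((s j : ℕ) : ℝ) + 1) / (((s ⟨0, hm0⟩ : ℕ) : ℝ) + 1) < p1 j ∨
        p2 j < (((s j : ℕ) : ℝ) + 1) / (((s ⟨0, hm0⟩ : ℕ) : ℝ) + 1)) := by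
      rcases hs with hs | hs
      · constructor
        · have h0 := hle ⟨0, hm0⟩
          push_cast at h0
          have : 0 < p1 j * ((((s ⟨0, hm0⟩ : ℕ) : ℝ) + 1) - n * ε - v) := by linarith
          have := (mul_pos_iff_of_pos_left hp1).1 this
          linarith
        · left
          rw [div_lt_iff₀ hs0]
          nlinarith [mul_nonneg hp1.le hv0]
      · constructor
        · have h0 := hle j
          push_cast at h0
          nlinarith [mul_nonneg (by linarith : (0:ℝ) ≤ p2 j) hv0]
        · right
          rw [lt_div_iff₀ hs0]
          nlinarith [mul_nonneg (by linarith : (0:ℝ) ≤ p2 j) hv0]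
    obtain ⟨hTn, hrat⟩ := hTn
    set q : Fin m → ℝ := fun j => (((s j : ℕ) + 1 : ℕ) : ℝ) / (((s ⟨0, hm0⟩ : ℕ) + 1 : ℕ) : ℝ)
      with hq
    have hqpos : ∀ j, 0 < q j := fun j => by positivity
    have hq0 : q ⟨0, hm0⟩ = 1 := by
      simp only [hq]; exact div_self (by positivity)
    have hgq : g q ≤ δStar := hoff q hqpos hq0 ⟨j, hj, by
      simp only [hq]; push_cast; exact hrat⟩
    have hA := expLV_le_g p hm0 S hS sStar hSb (fun j => (s j : ℕ) + 1) (fun j => by omega) (g q)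
      (hg q hqpos hq0)
    have hA' : expLV p (fun j => (s j : ℕ) + 1) S ≤ δStar * T / m := by
      refine hA.trans ?_
      have hT0 : 0 ≤ T := by linarith
      rw [div_le_div_iff_of_pos_right hm']
      exact mul_le_mul_of_nonneg_right hgq hT0
    have hB := expLV_le p hm0 S hS sStar hSb hSperm γ hγ (fun j => n - ((s j : ℕ) + 1))
    have hsum : ∑ j : Fin m, ((n - ((s j : ℕ) + 1) : ℕ) : ℝ) = m * n - T := by
      have : ∀ j : Fin m, ((n - ((s j : ℕ) + 1) : ℕ) : ℝ) = n - (((s j : ℕ) + 1 : ℕ) : ℝ) := by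
        intro j
        rw [Nat.cast_sub]
        have := (s j).2; omega
      simp only [this, Finset.sum_sub_distrib, hT]
      simp
    rw [hsum] at hB
    have hC : (γ - (γ - δStar - η) * ε / m) * n < expL p m n S := by
      rwa [lt_div_iff₀ hn'] at h1
    have hE' : expLV p (fun j => (s j : ℕ) + 1) S + expLV p (fun j => n - ((s j : ℕ) + 1)) S
      - expL p m n S ≤ -(η * ε * n / m) := by
      have e1 : δStar * T / m + γ * (m * n - T) / m = γ * n - (γ - δStar) * T / m := by
        field_simp; ring
      have e2 : (γ - (γ - δStar - η) * ε / m) * n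
          = γ * n - (γ - δStar) * (n * ε) / m + η * ε * n / m := by
        field_simp; ring
      have e3 : (γ - δStar) * (n * ε) / m ≤ (γ - δStar) * T / m := by
        rw [div_le_div_iff_of_pos_right hm']
        exact mul_le_mul_of_nonneg_left hTn (by linarith [hη.1, hη.2])
      linarith
    have hη0 := hη.1
    have hfin := gap_prob p hm0 hn0 S hS sStar hSb D hD0 hBD s (η * ε * n / m) (by positivity) hE'
    refine hfin.trans (le_of_eq ?_)
    congr 1
    rw [hK]
    push_cast
    field_simp
  have hEc : μ.real Eᶜ ≤ (n : ℝ) ^ m * Real.exp (-(n : ℝ) * K) := by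
    calc μ.real Eᶜ ≤ μ.real (⋃ s ∈ bad, {w | 0 ≤ cutGap S s w}) :=
          measureReal_mono hsub (measure_ne_top _ _)
      _ ≤ ∑ s ∈ bad, μ.real {w | 0 ≤ cutGap S s w} := measureReal_biUnion_finset_le _ _
      _ ≤ ∑ s ∈ bad, Real.exp (-(n : ℝ) * K) := Finset.sum_le_sum hone
      _ = bad.card * Real.exp (-(n : ℝ) * K) := by simp
      _ ≤ (n : ℝ) ^ m * Real.exp (-(n : ℝ) * K) := by
          gcongr
          have : bad.card ≤ n ^ m := by
            refine (Finset.card_le_univ _).trans ?_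
            simp
          exact_mod_cast this
  have hcover : 1 ≤ μ.real E + μ.real Eᶜ := by
    have := measureReal_union_le (μ := μ) E Eᶜ
    rw [Set.union_compl_self] at this
    simpa using this
  have hfinal : (n : ℝ) ^ m * Real.exp (-(n : ℝ) * K) ≤ Real.exp (-(n : ℝ) * (-κ + K)) := by
    have e1 : Real.exp (-(n : ℝ) * K)
        = Real.exp (-κ * n) * Real.exp (-(n : ℝ) * (-κ + K)) := by
      rw [← Real.exp_add]; congr 1; ring
    rw [e1, ← mul_assoc]
    exact mul_le_of_le_one_left (Real.exp_pos _).le h2.le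
  change _ ≤ μ.real E
  linarith

lemma exists_rep (A : Type*) [Finite A] [Nonempty A] [MeasurableSpace A] :
    ∃ r : A → A, (∀ s, MeasurableSet s → r ⁻¹' s = s) ∧ (∀ b, MeasurableSet (r ⁻¹' {b})) ∧
      ∀ a, r (r a) = r a := by
  set r : A → A := fun a => Function.invFun (measurableAtom (β := A)) (measurableAtom a) with hr
  have h1 : ∀ a, measurableAtom (r a) = measurableAtom a := fun a =>
    Function.invFun_eq (f := measurableAtom (β := A)) ⟨a, rfl⟩
  have h2 : ∀ a b, measurableAtom a = measurableAtom b → r a = r b := fun a b h => by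
    simp only [hr, h]
  have h3 : ∀ a, r (r a) = r a := fun a => h2 _ _ (h1 a)
  refine ⟨r, ?_, ?_, h3⟩
  · intro s hs
    ext a
    constructor
    · intro h
      exact measurableAtom_subset hs h (by rw [h1]; exact mem_measurableAtom_self a)
    · intro h
      exact measurableAtom_subset hs h (by rw [← h1]; exact mem_measurableAtom_self _)
  · intro b
    by_cases hb : r b = b
    · have : r ⁻¹' {b} = measurableAtom b := by
        ext a
        simp only [Set.mem_preimage, Set.mem_singleton_iff]
        constructor
        · intro h
          rw [← h, h1]; exact mem_measurableAtom_self _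
        · intro h
          rw [← hb]
          exact h2 _ _ (measurableAtom_eq_of_mem h)
      rw [this]
      exact MeasurableSet.measurableAtom_of_countable b
    · have : r ⁻¹' {b} = ∅ := by
        ext a
        simp only [Set.mem_preimage, Set.mem_singleton_iff, Set.mem_empty_iff_false, iff_false]
        intro h
        exact hb (by rw [← h, h3])
      rw [this]; exact MeasurableSet.empty

lemma pi_invariant {ι : Type*} {X : ι → Type*} [∀ i, MeasurableSpace (X i)]
    (r : ∀ i, X i → X i) (h : ∀ i s, MeasurableSet s → r i ⁻¹' s = s) (T : Set (∀ i, X i))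
    (hT : MeasurableSet T) : (fun x i => r i (x i)) ⁻¹' T = T := by
  have hle : (MeasurableSpace.pi : MeasurableSpace (∀ i, X i)) ≤
      @MeasurableSpace.invariants _ ⊤ (fun x i => r i (x i)) := by
    refine iSup_le fun i => ?_
    rintro _ ⟨s, hs, rfl⟩
    refine ⟨trivial, ?_⟩
    ext x
    have := Set.ext_iff.1 (h i s hs) (x i)
    exact this
  exact (hle T hT).2

lemma optScore_const {A : Type*} {m : ℕ} (hm : 0 < m) (n : ℕ) (S : (Fin m → A) → ℝ)
    (hS0 : ∀ x, 0 ≤ S x)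
    (sStar : ℝ) (hSb : ∀ x, S x ≤ sStar) (x : Fin m → A) :
    optScore m n S (fun j _ => x j) = n * S x := by
  change optScoreV m (fun _ => n) S (fun j _ => x j) = n * S x
  refine le_antisymm (optV_le _ _ _ _ fun k π hπ => ?_) ?_
  · have hk : k ≤ n := by
      simpa using Fintype.card_le_of_injective _ (hπ ⟨0, hm⟩).injective
    simp only [Finset.sum_const, Finset.card_univ, Fintype.card_fin, nsmul_eq_mul]
    have := hS0 x
    gcongr
  · have := le_optV hm (fun _ => n) S sStar hSb (fun j _ => x j) n (fun _ i => i)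
      (fun _ => strictMono_id)
    simpa using this

lemma S_rep {A : Type*} [Finite A] [MeasurableSpace A] (p : Measure A) [IsProbabilityMeasure p]
    {m : ℕ} (hm : 0 < m) (n : ℕ) (hn : 0 < n) (S : (Fin m → A) → ℝ)
    (hS0 : ∀ x, 0 ≤ S x) (sStar : ℝ) (hSb : ∀ x, S x ≤ sStar)
    (r : A → A) (hr1 : ∀ s, MeasurableSet s → r ⁻¹' s = s)
    (hr3 : ∀ a, r (r a) = r a)
    (hae : AEStronglyMeasurable (optScore m n S) (wordMeasure p m n))
    (x : Fin m → A) (hx : ∀ j, p (r ⁻¹' {r (x j)}) ≠ 0) : S x = S (fun j => r (x j)) := by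
  obtain ⟨f, hf, hfe⟩ := hae
  have hfm := hf.measurable
  have hinv : ∀ T : Set (Fin m → Fin n → A), MeasurableSet T →
      (fun w j i => r (w j i)) ⁻¹' T = T := by
    intro T hT
    exact pi_invariant (fun _ y i => r (y i))
      (fun _ s hs => pi_invariant (fun _ => r) (fun _ => hr1) s hs) T hT
  obtain ⟨T, hsub, hTm, hT0⟩ := exists_measurable_superset_of_null (ae_iff.1 hfe)
  set B : Set (Fin m → Fin n → A) :=
    Set.univ.pi fun j => Set.univ.pi fun _ => r ⁻¹' {r (x j)} with hB
  have hB0 : wordMeasure p m n B ≠ 0 := by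
    rw [hB, wordMeasure, Measure.pi_pi]
    refine Finset.prod_ne_zero_iff.2 fun j _ => ?_
    rw [Measure.pi_pi]
    exact Finset.prod_ne_zero_iff.2 fun i _ => hx j
  have key : ∀ y : Fin m → A, (∀ j, r (y j) = r (x j)) → (fun j (_ : Fin n) => y j) ∉ T := by
    intro y hy hyT
    apply hB0
    refine measure_mono_null ?_ hT0
    intro z hz
    rw [← hinv T hTm] at hyT ⊢
    have : (fun j i => r (z j i)) = (fun j (_ : Fin n) => r (y j)) := by
      ext j i
      have := hz j (Set.mem_univ _) i (Set.mem_univ _)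
      rw [hy]; exact this
    change (fun j i => r (z j i)) ∈ T
    rw [this]; exact hyT
  have e1 : ∀ y : Fin m → A, (∀ j, r (y j) = r (x j)) →
      (n : ℝ) * S y = f (fun j (_ : Fin n) => y j) := by
    intro y hy
    rw [← optScore_const hm n S hS0 sStar hSb y]
    by_contra hne
    exact key y hy (hsub hne)
  have e2 : f (fun j (_ : Fin n) => r (x j)) = f (fun j (_ : Fin n) => x j) := by
    have h := hinv (f ⁻¹' {f (fun j (_ : Fin n) => x j)}) (hfm (measurableSet_singleton _))
    have h' : (fun j (_ : Fin n) => x j) ∈ f ⁻¹' {f (fun j (_ : Fin n) => x j)} := rfl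
    rw [← h] at h'
    exact h'
  have h3 := e1 x fun _ => rfl
  have h4 := e1 (fun j => r (x j)) fun _ => hr3 _
  have hn' : (n : ℝ) ≠ 0 := by exact_mod_cast hn.ne'
  apply mul_left_cancel₀ hn'
  rw [h3, h4, e2]

lemma rep_measurable {A : Type*} [Finite A] [MeasurableSpace A] {m : ℕ} (S : (Fin m → A) → ℝ)
    (r : A → A) (hr2 : ∀ b, MeasurableSet (r ⁻¹' {b})) :
    Measurable (fun x : Fin m → A => S (fun j => r (x j))) := by
  intro s _
  have : (fun x : Fin m → A => S (fun j => r (x j))) ⁻¹' s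
      = ⋃ y ∈ {y : Fin m → A | S y ∈ s}, Set.univ.pi fun j => r ⁻¹' {y j} := by
    ext x
    simp only [Set.mem_preimage, Set.mem_iUnion, Set.mem_pi, Set.mem_univ, true_imp_iff,
      Set.mem_singleton_iff, Set.mem_ofPred_eq, exists_prop]
    constructor
    · intro h
      exact ⟨_, h, fun j => rfl⟩
    · rintro ⟨y, hy, h⟩
      have : (fun j => r (x j)) = y := funext h
      rwa [this]
  rw [this]
  exact MeasurableSet.biUnion (Set.to_countable _) fun y _ =>
    MeasurableSet.univ_pi fun j => hr2 _

lemma ae_letters {A : Type*} [Finite A] [MeasurableSpace A] (p : Measure A)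
    [IsProbabilityMeasure p] (r : A → A) {m : ℕ} (ℓ : Fin m → ℕ) :
    ∀ᵐ w ∂(wordMeasureV p ℓ), ∀ j i, p (r ⁻¹' {r (w j i)}) ≠ 0 := by
  have h0 : ∀ᵐ a ∂p, p (r ⁻¹' {r a}) ≠ 0 := by
    rw [ae_iff]
    have : {a | ¬ p (r ⁻¹' {r a}) ≠ 0} ⊆ ⋃ b ∈ {b | p (r ⁻¹' {b}) = 0}, r ⁻¹' {b} := by
      intro a ha
      have ha' : p (r ⁻¹' {r a}) = 0 := by simpa using ha
      simp only [Set.mem_iUnion]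
      exact ⟨r a, ha', rfl⟩
    refine measure_mono_null this ?_
    exact (measure_biUnion_null_iff (Set.to_countable _)).2 fun b hb => hb
  rw [ae_all_iff]; intro j
  rw [ae_all_iff]; intro i
  have h1 : ∀ᵐ u ∂(Measure.pi fun _ : Fin (ℓ j) => p), p (r ⁻¹' {r (u i)}) ≠ 0 :=
    (Measure.tendsto_eval_ae_ae (μ := fun _ : Fin (ℓ j) => p) (i := i)).eventually h0
  exact (Measure.tendsto_eval_ae_ae (μ := fun j : Fin m => Measure.pi fun _ : Fin (ℓ j) => p)
    (i := j)).eventually h1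

end Helpers

theorem stmt15
    {A : Type*} [Fintype A] [Nonempty A] [MeasurableSpace A]
    (p : Measure A) [IsProbabilityMeasure p]
    (m : ℕ) (hm : 2 ≤ m) (S : (Fin m → A) → ℝ) (hS0 : ∀ x, 0 ≤ S x)
    (sStar : ℝ) (hSb : ∀ x, S x ≤ sStar) (hSperm : PermInvariant S)
    (D : ℝ) (hD0 : 0 < D) (hBD : BddDiffOne S D)
    (γ δStar : ℝ)
    (hγ : Tendsto (fun n : ℕ => expL p m n S / n) atTop (nhds γ))
    (g : (Fin m → ℝ) → ℝ)
    (hg : ∀ q : Fin m → ℝ, (∀ j, 0 < q j) → q ⟨0, by omega⟩ = 1 →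
      Tendsto (fun n : ℕ => expLV p (fun j => ⌈(n : ℝ) * q j⌉₊) S /
        ((n : ℝ) * (∑ j, q j) / m)) atTop (nhds (g q)))
    (p1 p2 : Fin m → ℝ)
    (hp : ∀ j : Fin m, (j : ℕ) ≠ 0 → 0 < p1 j ∧ p1 j < 1 ∧ 1 < p2 j)
    (hoff : ∀ q : Fin m → ℝ, (∀ j, 0 < q j) → q ⟨0, by omega⟩ = 1 →
      (∃ j : Fin m, (j : ℕ) ≠ 0 ∧ (q j < p1 j ∨ p2 j < q j)) → g q ≤ δStar)
    (hδ : 0 < δStar ∧ δStar < γ)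
    (η ε : ℝ) (hη : 0 < η ∧ η < γ - δStar) (hε : 0 < ε)
    (v : ℕ) (hv1 : 1 ≤ v)
    (hv : (1 + Real.log (1 + v)) / v ≤
      η ^ 2 * ε ^ 2 / (2 * (m : ℝ) ^ 3 * ((m : ℝ) - 1) * D ^ 2)) :
    ∃ N : ℕ, ∀ n d : ℕ, N ≤ n → n = v * d →
      1 - 2 * ((m : ℝ) - 1) *
          Real.exp (-(n : ℝ) * (-((1 + Real.log (1 + v)) / v) * ((m : ℝ) - 1) +
            η ^ 2 * ε ^ 2 / (2 * (m : ℝ) ^ 3 * D ^ 2))) ≤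
        ((wordMeasure p m n) {w | ∀ (k : ℕ) (π : Fin m → Fin k → Fin n),
          (∀ j, StrictMono (π j)) → alignScore S w π = optScore m n S w →
          ∀ (i : Fin k) (j : Fin m), (j : ℕ) ≠ 0 →
            p1 j * (((π ⟨0, by omega⟩ i : ℕ) : ℝ) + 1) - p1 j * n * ε - p1 j * v ≤
                ((π j i : ℕ) : ℝ) + 1 ∧
            ((π j i : ℕ) : ℝ) + 1 ≤
                p2 j * (((π ⟨0, by omega⟩ i : ℕ) : ℝ) + 1) + p2 j * n * ε + p2 j * v}).toReal := by
  have hm0 : 0 < m := lt_of_lt_of_le Nat.zero_lt_two hm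
  have hm2 : (2 : ℝ) ≤ m := by exact_mod_cast hm
  obtain ⟨r, hr1, hr2, hr3⟩ := exists_rep A
  have hγ0 : 0 < γ := hδ.1.trans hδ.2
  obtain ⟨n0, hn0, hn0'⟩ := ((hγ.eventually_const_lt hγ0).and (eventually_gt_atTop 0)).exists
  have hae : AEStronglyMeasurable (optScore m n0 S) (wordMeasure p m n0) := by
    by_contra hcon
    have : expL p m n0 S = 0 := integral_undef fun h => hcon h.1
    rw [this] at hn0
    simp at hn0
  have hSr := S_rep p hm0 n0 hn0' S hS0 sStar hSb r hr1 hr3 hae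
  set S' : (Fin m → A) → ℝ := fun x => S (fun j => r (x j)) with hS'
  have hopt : ∀ ℓ : Fin m → ℕ, ∀ᵐ w ∂(wordMeasureV p ℓ),
      optScoreV m ℓ S w = optScoreV m ℓ S' w := by
    intro ℓ
    filter_upwards [ae_letters p r ℓ] with w hw
    unfold optScoreV
    congr 1
    ext x
    have : ∀ (k : ℕ) (π : ∀ j : Fin m, Fin k → Fin (ℓ j)),
        ∑ i : Fin k, S (fun j => w j (π j i)) = ∑ i : Fin k, S' (fun j => w j (π j i)) :=
      fun k π => Finset.sum_congr rfl fun i _ => hSr _ fun j => hw _ _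
    simp only [this]
  have hexp : ∀ ℓ : Fin m → ℕ, expLV p ℓ S = expLV p ℓ S' := fun ℓ => integral_congr_ae (hopt ℓ)
  have hexpL : ∀ n, expL p m n S = expL p m n S' := fun n => hexp fun _ => n
  simp only [hexp] at hg
  simp only [hexpL] at hγ
  have hv' : (1 : ℝ) ≤ v := by exact_mod_cast hv1
  have hlog : 0 ≤ Real.log (1 + v) := Real.log_nonneg (by linarith)
  have hκ : 0 < (1 + Real.log (1 + v)) / v * ((m : ℝ) - 1) := by
    apply mul_pos
    · positivity
    · linarith
  obtain ⟨N, hN⟩ := main_meas p m hm0 S' (rep_measurable S r hr2) sStar (fun x => hSb _)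
    (fun σ x => hSperm σ (fun j => r (x j))) D hD0
    (fun x y ⟨j0, h⟩ => hBD _ _ ⟨j0, fun j hj => by simp only [h j hj]⟩)
    γ δStar hγ g hg p1 p2 hp hoff η ε hη hε v _ hκ
  refine ⟨N, fun n d hn _ => ?_⟩
  have h := hN n hn
  have : IsProbabilityMeasure (wordMeasure p m n) := by rw [wordMeasure]; infer_instance
  have hle : ∀ x : ℝ, 1 - 2 * ((m : ℝ) - 1) * Real.exp x ≤ 1 - Real.exp x := fun x => by
    nlinarith [Real.exp_pos x]
  rw [neg_mul ((1 + Real.log (1 + v)) / v) ((m : ℝ) - 1)]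
  refine (hle _).trans (h.trans ?_)
  refine ENNReal.toReal_mono (measure_ne_top _ _) ?_
  refine measure_mono_ae ?_
  have hae2 := (ae_letters p r (fun _ : Fin m => n)).and (hopt fun _ => n)
  filter_upwards [hae2] with w hw hE
  intro k π hπ hsc
  refine hE k π hπ ?_
  have h1 : alignScore S w π = alignScore S' w π :=
    Finset.sum_congr rfl fun i _ => hSr _ fun j => hw.1 _ _
  have h2 : optScore m n S w = optScore m n S' w := hw.2
  rw [← h1, ← h2]; exact hsc
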